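/- For every integer r and all p_0 < 1, ε > 0, and K, there exist a positive λ and a constant C such that the following holds. Let V be a finite set, let H be a nonempty r-uniform hypergraph on V with weight function d : H → (0,∞), let p ∈ (0, p_0], and let R be the p-random subset of V. Suppose that for every s ∈ {1,…,r}, Δ_s(H) ≤ K·(λp)^{s−1}·e(H)/v(H). Then, setting X := e(H[R]), for every nonnegative real η, −log Pr(X ≤ η·E[X]) ≥ (1−ε)·Φ_p^H(η+ε) − C. -/

import Mathlib

open Classical

noncomputable section

/-- The probability of the configuration `ω ⊆ V` under the product measure in which
each vertex `v` is retained independently with probability `q v`. -/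
def pw {V : Type*} [Fintype V] [DecidableEq V] (q : V → ℝ) (ω : Finset V) : ℝ :=
  (∏ v ∈ ω, q v) * ∏ v ∈ ωᶜ, (1 - q v)

/-- The relative entropy `i_p(q) = D_KL(Ber(q) ‖ Ber(p))`.  (In Lean `Real.log 0 = 0`,
which implements the convention `0 · log 0 = 0`.) -/
def ip (p q : ℝ) : ℝ :=
  q * Real.log (q / p) + (1 - q) * Real.log ((1 - q) / (1 - p))

/-- `e(H[ω])`: the total weight of the edges of the weighted hypergraph `(H, d)`
induced by the set `ω`. -/
def eInd {V : Type*} [DecidableEq V] (H : Finset (Finset V)) (d : Finset V → ℝ)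
    (ω : Finset V) : ℝ :=
  ∑ A ∈ H, if A ⊆ ω then d A else 0

/-- `e(H)`: the total weight of the weighted hypergraph `(H, d)`. -/
def eTot {V : Type*} (H : Finset (Finset V)) (d : Finset V → ℝ) : ℝ :=
  ∑ A ∈ H, d A

/-- `deg_H B`: the total weight of the edges of `(H, d)` containing `B`. -/
def degH {V : Type*} [DecidableEq V] (H : Finset (Finset V)) (d : Finset V → ℝ)
    (B : Finset V) : ℝ :=
  ∑ A ∈ H, if B ⊆ A then d A else 0

/-- `E[e(H[R^{(q)}])]`: the expected induced edge weight when each vertex `v` is retained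
independently with probability `q v`. -/
def expE {V : Type*} [Fintype V] [DecidableEq V] (H : Finset (Finset V))
    (d : Finset V → ℝ) (q : V → ℝ) : ℝ :=
  ∑ ω : Finset V, pw q ω * eInd H d ω

/-- `Φ_p^H(η)`: the least relative entropy `∑_{v} i_p(q_v)` of a product measure under
which the expected induced edge weight is at most `η` times that of the `p`-random subset. -/
def PhiH {V : Type*} [Fintype V] [DecidableEq V] (H : Finset (Finset V))
    (d : Finset V → ℝ) (p η : ℝ) : ℝ :=
  sInf {x | ∃ q : V → ℝ, (∀ v, q v ∈ Set.Icc (0 : ℝ) 1) ∧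
    expE H d q ≤ η * expE H d (fun _ => p) ∧ x = ∑ v, ip p (q v)}

/-- `Pr(X ≤ η E[X])` where `X = e(H[R])` and `R` is the `p`-random subset of `V`. -/
def lowPr {V : Type*} [Fintype V] [DecidableEq V] (H : Finset (Finset V))
    (d : Finset V → ℝ) (p η : ℝ) : ℝ :=
  ∑ ω : Finset V,
    if eInd H d ω ≤ η * expE H d (fun _ => p) then pw (fun _ => p) ω else 0

section Helpers

open Finset

variable {V : Type*} [DecidableEq V]

/-- `g` depends only on the trace of the configuration on `W`. -/
def DependsOnTrace (W : Finset V) (g : Finset V → ℝ) : Prop :=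
  ∀ ω ω', ω ∩ W = ω' ∩ W → g ω = g ω'

theorem DependsOnTrace.mono {W W' : Finset V} (h : W ⊆ W') {g : Finset V → ℝ}
    (hg : DependsOnTrace W g) : DependsOnTrace W' g := by
  intro ω ω' hω
  apply hg
  rw [← inter_eq_right.2 h, ← inter_assoc, hω, inter_assoc]

theorem DependsOnTrace.mul {W : Finset V} {f g : Finset V → ℝ}
    (hf : DependsOnTrace W f) (hg : DependsOnTrace W g) :
    DependsOnTrace W fun ω => f ω * g ω :=
  fun ω ω' h => by simp only [hf ω ω' h, hg ω ω' h]

variable [Fintype V]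

/-! ### Sums against product measures -/

theorem sum_pw_mul_prod (q a b : V → ℝ) :
    ∑ U : Finset V, pw q U * ((∏ i ∈ U, a i) * ∏ i ∈ Uᶜ, b i) =
      ∏ i, (q i * a i + (1 - q i) * b i) := by
  rw [Finset.prod_add, powerset_univ]
  refine sum_congr rfl fun U _ => ?_
  rw [pw, ← compl_eq_univ_sdiff, prod_mul_distrib, prod_mul_distrib]
  ring

theorem sum_pw_subset (q : V → ℝ) (S : Finset V) :
    ∑ U : Finset V, pw q U * (if S ⊆ U then 1 else 0) = ∏ i ∈ S, q i := by
  have h := sum_pw_mul_prod q (fun _ => 1) (fun i => if i ∈ S then 0 else 1)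
  have h1 : ∀ U : Finset V, (if S ⊆ U then (1 : ℝ) else 0) =
      (∏ _i ∈ U, (1 : ℝ)) * ∏ i ∈ Uᶜ, (if i ∈ S then (0 : ℝ) else 1) := by
    intro U
    rw [prod_const_one, one_mul]
    split_ifs with hS
    · refine (prod_eq_one fun i hi => ?_).symm
      rw [if_neg fun h => (mem_compl.1 hi) (hS h)]
    · obtain ⟨i, hi, hU⟩ := not_subset.1 hS
      exact (prod_eq_zero (i := i) (by simpa using hU) (by simp [hi])).symm
  simp_rw [h1]
  rw [h, ← prod_subset (subset_univ S) fun i _ hi => by simp [hi]]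
  exact prod_congr rfl fun i hi => by simp [hi]

theorem sum_pw (q : V → ℝ) : ∑ U : Finset V, pw q U = 1 := by
  simpa using sum_pw_subset q ∅

theorem sum_pw_subset_notMem (q : V → ℝ) {S : Finset V} {v : V} (hv : v ∉ S) :
    ∑ U : Finset V, pw q U * (if S ⊆ U ∧ v ∉ U then 1 else 0) = (∏ i ∈ S, q i) * (1 - q v) := by
  have h : ∀ U : Finset V, (if S ⊆ U ∧ v ∉ U then (1 : ℝ) else 0) =
      (if S ⊆ U then 1 else 0) - (if insert v S ⊆ U then 1 else 0) := by
    intro U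
    by_cases h1 : S ⊆ U <;> by_cases h2 : v ∈ U <;> simp [h1, h2, insert_subset_iff]
  simp_rw [h, mul_sub]
  rw [sum_sub_distrib, sum_pw_subset, sum_pw_subset, prod_insert hv]
  ring

theorem pw_nonneg {q : V → ℝ} (h : ∀ v, q v ∈ Set.Icc (0 : ℝ) 1) (ω : Finset V) : 0 ≤ pw q ω :=
  mul_nonneg (prod_nonneg fun v _ => (h v).1) (prod_nonneg fun v _ => sub_nonneg.2 (h v).2)

theorem pw_insert (q : V → ℝ) {v : V} {ω : Finset V} (hv : v ∉ ω) :
    (1 - q v) * pw q (insert v ω) = q v * pw q ω := by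
  have h : ωᶜ = insert v (insert v ω)ᶜ := by
    ext x
    by_cases hx : x = v <;> simp [hx, hv]
  rw [pw, pw, h, prod_insert hv, prod_insert (by simp)]
  ring

theorem expE_eq (H : Finset (Finset V)) (d : Finset V → ℝ) (q : V → ℝ) :
    expE H d q = ∑ A ∈ H, d A * ∏ v ∈ A, q v := by
  simp_rw [expE, eInd, mul_sum]
  rw [sum_comm]
  refine sum_congr rfl fun A _ => ?_
  rw [← sum_pw_subset, mul_sum]
  refine sum_congr rfl fun ω _ => ?_
  split_ifs <;> ring

theorem sum_finset_split (v : V) (F : Finset V → ℝ) :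
    ∑ ω, F ω = ∑ ω ∈ (univ.erase v).powerset, (F ω + F (insert v ω)) := by
  rw [sum_add_distrib, ← sum_powerset_insert (notMem_erase v univ), insert_erase (mem_univ v),
    powerset_univ]

/-! ### Conditional expectations on a finite cube -/

/-- Conditional expectation of `f` under the weights `μ`, given the trace on `W`. -/
def cE (μ : Finset V → ℝ) (W : Finset V) (f : Finset V → ℝ) (ω : Finset V) : ℝ :=
  (∑ ω' with ω' ∩ W = ω ∩ W, μ ω' * f ω') / ∑ ω' with ω' ∩ W = ω ∩ W, μ ω'

/-- Conditional probability under `μ` that `v` is retained, given the trace on `W`. -/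
def cP (μ : Finset V → ℝ) (W : Finset V) (v : V) : Finset V → ℝ :=
  cE μ W fun ω => if v ∈ ω then 1 else 0

theorem dependsOnTrace_cE (μ : Finset V → ℝ) (W : Finset V) (f : Finset V → ℝ) :
    DependsOnTrace W (cE μ W f) := by
  intro ω ω' h
  simp only [cE, h]

theorem dependsOnTrace_cP (μ : Finset V → ℝ) (W : Finset V) (v : V) :
    DependsOnTrace W (cP μ W v) :=
  dependsOnTrace_cE _ _ _

theorem sum_mul_cE {μ : Finset V → ℝ} (hμ : ∀ ω, 0 ≤ μ ω) {W : Finset V} (f : Finset V → ℝ)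
    {g : Finset V → ℝ} (hg : DependsOnTrace W g) :
    ∑ ω, μ ω * (g ω * cE μ W f ω) = ∑ ω, μ ω * (g ω * f ω) := by
  have h1 : ∀ ω, μ ω * (g ω * cE μ W f ω) = ∑ ω', if ω' ∩ W = ω ∩ W then
      μ ω * (g ω * (μ ω' * f ω' / ∑ ω' with ω' ∩ W = ω ∩ W, μ ω')) else 0 := by
    intro ω
    rw [← sum_filter, cE, sum_div, mul_sum, mul_sum]
  simp_rw [h1]
  rw [sum_comm]
  refine sum_congr rfl fun ω' _ => ?_
  have h2 : ∀ ω, (if ω' ∩ W = ω ∩ W then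
      μ ω * (g ω * (μ ω' * f ω' / ∑ ω' with ω' ∩ W = ω ∩ W, μ ω')) else 0) =
      (if ω ∩ W = ω' ∩ W then μ ω else 0) *
        (g ω' * (μ ω' * f ω' / ∑ ω with ω ∩ W = ω' ∩ W, μ ω)) := by
    intro ω
    by_cases h : ω ∩ W = ω' ∩ W
    · rw [if_pos h.symm, if_pos h, hg ω ω' h, h]
    · rw [if_neg fun h' => h h'.symm, if_neg h, zero_mul]
  simp_rw [h2]
  rw [← sum_mul, ← sum_filter]
  rcases (hμ ω').eq_or_lt with h0 | h0
  · simp [← h0]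
  · have hpos : 0 < ∑ ω with ω ∩ W = ω' ∩ W, μ ω :=
      h0.trans_le (single_le_sum (f := μ) (fun ω _ => hμ ω) (by simp))
    field_simp

theorem sum_mul_cP {μ : Finset V → ℝ} (hμ : ∀ ω, 0 ≤ μ ω) {W : Finset V} (v : V)
    {g : Finset V → ℝ} (hg : DependsOnTrace W g) :
    ∑ ω, μ ω * (g ω * cP μ W v ω) = ∑ ω, μ ω * (g ω * if v ∈ ω then 1 else 0) :=
  sum_mul_cE hμ _ hg

theorem cE_le {μ : Finset V → ℝ} (hμ : ∀ ω, 0 ≤ μ ω) {W : Finset V} {f : Finset V → ℝ} {c : ℝ}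
    (hc : 0 ≤ c) (hf : ∀ ω, μ ω ≠ 0 → f ω ≤ c) (ω : Finset V) : cE μ W f ω ≤ c := by
  refine div_le_of_le_mul₀ (sum_nonneg fun ω _ => hμ ω) hc ?_
  rw [mul_sum]
  refine sum_le_sum fun ω' _ => ?_
  rw [mul_comm c]
  rcases eq_or_ne (μ ω') 0 with h | h
  · simp [h]
  · exact mul_le_mul_of_nonneg_left (hf ω' h) (hμ ω')

theorem cP_nonneg {μ : Finset V → ℝ} (hμ : ∀ ω, 0 ≤ μ ω) (W : Finset V) (v : V) (ω : Finset V) :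
    0 ≤ cP μ W v ω :=
  div_nonneg (sum_nonneg fun ω _ => mul_nonneg (hμ ω) (by positivity))
    (sum_nonneg fun ω _ => hμ ω)

theorem cP_le_one {μ : Finset V → ℝ} (hμ : ∀ ω, 0 ≤ μ ω) (W : Finset V) (v : V) (ω : Finset V) :
    cP μ W v ω ≤ 1 :=
  cE_le hμ zero_le_one (fun ω _ => by split_ifs <;> norm_num) ω

theorem sum_sq_cP_sub {μ : Finset V → ℝ} (hμ : ∀ ω, 0 ≤ μ ω) {W W' : Finset V} (h : W ⊆ W')
    (v : V) :
    ∑ ω, μ ω * (cP μ W v ω - cP μ W' v ω) ^ 2 =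
      ∑ ω, μ ω * cP μ W' v ω ^ 2 - ∑ ω, μ ω * cP μ W v ω ^ 2 := by
  have h1 := sum_mul_cP hμ v (dependsOnTrace_cP μ W v)
  have h2 := sum_mul_cP hμ v ((dependsOnTrace_cP μ W v).mono h)
  have h3 : ∑ ω, μ ω * (cP μ W v ω - cP μ W' v ω) ^ 2 =
      ∑ ω, μ ω * cP μ W' v ω ^ 2 + ∑ ω, μ ω * (cP μ W v ω * cP μ W v ω) -
        2 * ∑ ω, μ ω * (cP μ W v ω * cP μ W' v ω) := by
    rw [mul_sum, ← sum_add_distrib, ← sum_sub_distrib]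
    exact sum_congr rfl fun ω _ => by ring
  have h4 : ∑ ω, μ ω * cP μ W v ω ^ 2 = ∑ ω, μ ω * (cP μ W v ω * cP μ W v ω) :=
    sum_congr rfl fun ω _ => by ring
  rw [h3, h4, h2, h1]
  ring

/-! ### Measures below the `p`-random subset -/

theorem sum_mul_mem_le {μ : Finset V → ℝ} {p : ℝ}
    (hμp : ∀ v ω, v ∉ ω → (1 - p) * μ (insert v ω) ≤ p * μ ω) {v : V} {g : Finset V → ℝ}
    (hg : ∀ ω, 0 ≤ g ω) (hgv : ∀ ω, g (insert v ω) = g ω) :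
    ∑ ω, μ ω * (g ω * if v ∈ ω then 1 else 0) ≤ p * ∑ ω, μ ω * g ω := by
  rw [sum_finset_split v, sum_finset_split v (fun ω => μ ω * g ω), mul_sum]
  refine sum_le_sum fun ω hω => ?_
  have hv : v ∉ ω := fun h => by simpa using (mem_powerset.1 hω) h
  simp only [hv, if_false, mem_insert_self, if_true, hgv]
  nlinarith [mul_le_mul_of_nonneg_right (hμp v ω hv) (hg ω)]

theorem sum_subset_le_pow {μ : Finset V → ℝ} {p : ℝ} (hp : 0 ≤ p) (hμ1 : ∑ ω, μ ω = 1)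
    (hμp : ∀ v ω, v ∉ ω → (1 - p) * μ (insert v ω) ≤ p * μ ω) (S : Finset V) :
    ∑ ω, μ ω * (if S ⊆ ω then 1 else 0) ≤ p ^ #S := by
  induction S using Finset.induction_on with
  | empty => simp [hμ1]
  | insert v S hv ih =>
    have h := sum_mul_mem_le hμp (v := v) (g := fun ω => if S ⊆ ω then 1 else 0)
      (fun ω => by positivity) (fun ω => by simp only [subset_insert_iff_of_notMem hv])
    rw [card_insert_of_notMem hv, pow_succ']
    refine le_trans (le_of_eq ?_) (h.trans (mul_le_mul_of_nonneg_left ih hp))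
    refine sum_congr rfl fun ω _ => ?_
    by_cases h1 : S ⊆ ω <;> by_cases h2 : v ∈ ω <;> simp [h1, h2, insert_subset_iff]

theorem cP_le {μ : Finset V → ℝ} {p : ℝ} (hp : 0 ≤ p) (hμ : ∀ ω, 0 ≤ μ ω)
    (hμp : ∀ v ω, v ∉ ω → (1 - p) * μ (insert v ω) ≤ p * μ ω) {W : Finset V} {v : V}
    (hv : v ∉ W) (ω : Finset V) : cP μ W v ω ≤ p := by
  refine div_le_of_le_mul₀ (sum_nonneg fun ω _ => hμ ω) hp ?_
  have h := sum_mul_mem_le hμp (v := v) (g := fun ω' => if ω' ∩ W = ω ∩ W then 1 else 0)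
      (fun ω => by positivity) (fun ω => by simp only [insert_inter_of_notMem hv])
  rw [sum_filter, sum_filter]
  refine (le_of_eq ?_).trans (h.trans (le_of_eq ?_))
  · exact sum_congr rfl fun ω' _ => by by_cases h1 : ω' ∩ W = ω ∩ W <;> simp [h1]
  · congr 1
    exact sum_congr rfl fun ω' _ => by split_ifs <;> simp

/-! ### The entropy bound -/

theorem sum_pw_reweight {p : ℝ} (hp : 0 < p) (hp1 : p < 1) {v : V} {q g : Finset V → ℝ}
    (hq : ∀ ω, q (insert v ω) = q ω) (hg : ∀ ω, g (insert v ω) = g ω) :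
    ∑ ω, pw (fun _ => p) ω * (g ω * if v ∈ ω then q ω / p else (1 - q ω) / (1 - p)) =
      ∑ ω, pw (fun _ => p) ω * g ω := by
  rw [sum_finset_split v, sum_finset_split v (fun ω => pw (fun _ => p) ω * g ω)]
  refine sum_congr rfl fun ω hω => ?_
  have hv : v ∉ ω := fun h => by simpa using (mem_powerset.1 hω) h
  have h1 : pw (fun _ => p) (insert v ω) = p * pw (fun _ => p) ω / (1 - p) := by
    rw [eq_div_iff (by linarith), ← pw_insert (fun _ => p) hv]
    ring
  have h2 : 1 - p ≠ 0 := by linarith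
  simp only [hv, if_false, mem_insert_self, if_true, hq, hg, h1]
  field_simp
  ring

theorem sum_pw_reweight_prod {p : ℝ} (hp : 0 < p) (hp1 : p < 1) {W T : Finset V}
    (hT : Disjoint T W) {q : V → Finset V → ℝ} (hq : ∀ v, DependsOnTrace W (q v)) :
    ∑ ω, pw (fun _ => p) ω *
      ∏ v ∈ T, (if v ∈ ω then q v ω / p else (1 - q v ω) / (1 - p)) = 1 := by
  induction T using Finset.induction_on with
  | empty => simp [sum_pw]
  | insert v T hv ih =>
    rw [disjoint_insert_left] at hT
    have hq' : ∀ u ω, q u (insert v ω) = q u ω := fun u ω =>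
      hq u _ _ (insert_inter_of_notMem hT.1)
    refine Eq.trans ?_ ((sum_pw_reweight hp hp1 (v := v) (q := q v) (hq' v) ?_).trans (ih hT.2))
    · refine sum_congr rfl fun ω _ => ?_
      rw [prod_insert hv, mul_comm (ite _ _ _)]
    · intro ω
      refine prod_congr rfl fun u hu => ?_
      have : u ≠ v := ne_of_mem_of_not_mem hu hv
      simp only [mem_insert, this, false_or, hq']

theorem sum_ip_cP_le {p : ℝ} (hp : 0 < p) (hp1 : p < 1) {L : Finset V → Prop} {P : ℝ}
    (hP : P = ∑ ω, if L ω then pw (fun _ => p) ω else 0) (hP0 : 0 < P) {μ : Finset V → ℝ}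
    (hμ : μ = fun ω => (if L ω then pw (fun _ => p) ω else 0) / P) (W : Finset V) :
    ∑ ω, μ ω * ∑ v ∈ Wᶜ, ip p (cP μ W v ω) ≤ -Real.log P := by
  have hπ : ∀ ω : Finset V, 0 ≤ pw (fun _ => p) ω := pw_nonneg fun _ => ⟨hp.le, hp1.le⟩
  have hμ0 : ∀ ω, 0 ≤ μ ω := fun ω => by
    rw [hμ]
    have := hπ ω
    positivity
  have hμ1 : ∑ ω, μ ω = 1 := by
    rw [hμ, ← sum_div, ← hP, div_self hP0.ne']
  set b : V → Finset V → ℝ := fun v ω =>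
    if v ∈ ω then cP μ W v ω / p else (1 - cP μ W v ω) / (1 - p) with hb
  have hlog : ∀ v, ∑ ω, μ ω * ip p (cP μ W v ω) = ∑ ω, μ ω * Real.log (b v ω) := by
    intro v
    have hd : ∀ F : ℝ → ℝ, DependsOnTrace W fun ω => F (cP μ W v ω) :=
      fun F ω ω' h => by simp only [dependsOnTrace_cP μ W v ω ω' h]
    have h1 := sum_mul_cP hμ0 v (hd fun x => Real.log (x / p) - Real.log ((1 - x) / (1 - p)))
    calc _ = ∑ ω, μ ω * ((Real.log (cP μ W v ω / p) - Real.log ((1 - cP μ W v ω) / (1 - p))) *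
              cP μ W v ω) + ∑ ω, μ ω * Real.log ((1 - cP μ W v ω) / (1 - p)) := by
            rw [← sum_add_distrib]
            exact sum_congr rfl fun ω _ => by rw [ip]; ring
      _ = _ := by
            rw [h1, ← sum_add_distrib]
            refine sum_congr rfl fun ω _ => ?_
            simp only [hb]
            split_ifs <;> ring
  have hbpos : ∀ v ω, μ ω ≠ 0 → 0 < b v ω := by
    intro v ω hω
    have hω' : 0 < μ ω := lt_of_le_of_ne (hμ0 ω) hω.symm
    have hden : μ ω ≤ ∑ ω' with ω' ∩ W = ω ∩ W, μ ω' :=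
      single_le_sum (f := μ) (fun ω _ => hμ0 ω) (by simp)
    simp only [hb]
    split_ifs with hv
    · refine div_pos (div_pos ?_ (hω'.trans_le hden)) hp
      refine sum_pos' (fun ω' _ => mul_nonneg (hμ0 _) (by positivity)) ⟨ω, by simp, ?_⟩
      simpa [hv] using hω'
    · refine div_pos (sub_pos.2 ?_) (sub_pos.2 hp1)
      rw [cP, cE, div_lt_one (hω'.trans_le hden)]
      refine sum_lt_sum (fun ω' _ => ?_) ⟨ω, by simp, ?_⟩
      · exact mul_le_of_le_one_right (hμ0 _) (by split_ifs <;> norm_num)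
      · simpa [hv] using hω'
  have hpt : ∀ ω, μ ω * ∑ v ∈ Wᶜ, Real.log (b v ω) ≤
      pw (fun _ => p) ω * ∏ v ∈ Wᶜ, b v ω - μ ω - μ ω * Real.log P := by
    intro ω
    have hbn : ∀ v, 0 ≤ b v ω := fun v => by
      simp only [hb]
      have := cP_nonneg hμ0 W v ω
      have := cP_le_one hμ0 W v ω
      split_ifs
      · positivity
      · exact div_nonneg (by linarith) (by linarith)
    rcases eq_or_ne (μ ω) 0 with h0 | h0
    · rw [h0]
      have := mul_nonneg (hπ ω) (prod_nonneg fun v (_ : v ∈ Wᶜ) => hbn v)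
      linarith
    · rw [← Real.log_prod fun v _ => (hbpos v ω h0).ne']
      have hZ : 0 < ∏ v ∈ Wᶜ, b v ω := prod_pos fun v _ => hbpos v ω h0
      have h1 := Real.log_le_sub_one_of_pos (mul_pos hZ hP0)
      rw [Real.log_mul hZ.ne' hP0.ne'] at h1
      have h2 : μ ω * P = pw (fun _ => p) ω := by
        rw [hμ] at h0 ⊢
        by_cases hL : L ω
        · simp only [hL, if_true]
          field_simp
        · simp [hL] at h0
      rw [← h2]
      nlinarith [mul_le_mul_of_nonneg_left h1 (hμ0 ω)]
  calc _ = ∑ ω, μ ω * ∑ v ∈ Wᶜ, Real.log (b v ω) := by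
        simp_rw [mul_sum]
        rw [sum_comm, sum_congr rfl fun v _ => hlog v, sum_comm]
    _ ≤ ∑ ω, (pw (fun _ => p) ω * ∏ v ∈ Wᶜ, b v ω - μ ω - μ ω * Real.log P) :=
        sum_le_sum fun ω _ => hpt ω
    _ = -Real.log P := by
        rw [sum_sub_distrib, sum_sub_distrib, ← sum_mul, hμ1,
          sum_pw_reweight_prod hp hp1 (disjoint_compl_left) (fun v => dependsOnTrace_cP μ W v)]
        ring

/-! ### Iterated random subsets -/

/-- The law of the union of `i` independent `t`-random subsets. -/
def unionLaw (t : ℝ) : ℕ → Finset V → ℝ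
  | 0, W => if W = ∅ then 1 else 0
  | i + 1, W' => ∑ W, unionLaw t i W * ∑ U, pw (fun _ => t) U * if W ∪ U = W' then 1 else 0

theorem sum_unionLaw_succ (t : ℝ) (i : ℕ) (g : Finset V → ℝ) :
    ∑ W, unionLaw t (i + 1) W * g W =
      ∑ W, unionLaw t i W * ∑ U, pw (fun _ => t) U * g (W ∪ U) := by
  simp_rw [unionLaw, sum_mul]
  rw [sum_comm]
  refine sum_congr rfl fun W _ => ?_
  simp_rw [mul_assoc]
  rw [← mul_sum]
  congr 1
  simp_rw [sum_mul]
  rw [sum_comm]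
  refine sum_congr rfl fun U _ => ?_
  simp

theorem unionLaw_nonneg {t : ℝ} (ht : t ∈ Set.Icc (0 : ℝ) 1) (i : ℕ) (W : Finset V) :
    0 ≤ unionLaw t i W := by
  induction i generalizing W with
  | zero => rw [unionLaw]; positivity
  | succ i ih =>
    rw [unionLaw]
    exact sum_nonneg fun W _ => mul_nonneg (ih W) (sum_nonneg fun U _ =>
      mul_nonneg (pw_nonneg (fun _ => ht) U) (by positivity))

theorem sum_unionLaw (t : ℝ) (i : ℕ) : ∑ W : Finset V, unionLaw t i W = 1 := by
  induction i with
  | zero => simp [unionLaw]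
  | succ i ih => simpa [sum_pw, ih] using sum_unionLaw_succ t i (fun _ : Finset V => (1 : ℝ))

theorem sum_unionLaw_mem_le {t : ℝ} (ht : t ∈ Set.Icc (0 : ℝ) 1) (i : ℕ) (v : V) :
    ∑ W, unionLaw t i W * (if v ∈ W then 1 else 0) ≤ i * t := by
  induction i with
  | zero =>
    rw [Nat.cast_zero, zero_mul]
    refine sum_nonpos fun W _ => ?_
    by_cases h : W = ∅ <;> simp [unionLaw, h]
  | succ i ih =>
    rw [sum_unionLaw_succ]
    calc _ ≤ ∑ W, unionLaw t i W * ((if v ∈ W then 1 else 0) + t) := by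
          refine sum_le_sum fun W _ => mul_le_mul_of_nonneg_left ?_ (unionLaw_nonneg ht i W)
          have h := sum_pw_subset (fun _ : V => t) {v}
          rw [prod_singleton] at h
          calc _ ≤ ∑ U, pw (fun _ => t) U *
                ((if v ∈ W then 1 else 0) + if {v} ⊆ U then 1 else 0) := by
                refine sum_le_sum fun U _ =>
                  mul_le_mul_of_nonneg_left ?_ (pw_nonneg (fun _ => ht) U)
                by_cases h1 : v ∈ W <;> by_cases h2 : v ∈ U <;> simp [h1, h2]
            _ = _ := by
                simp_rw [mul_add]
                rw [sum_add_distrib, h, ← sum_mul, sum_pw, one_mul]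
      _ = ∑ W, unionLaw t i W * (if v ∈ W then 1 else 0) + t := by
          simp_rw [mul_add]
          rw [sum_add_distrib, ← sum_mul, sum_unionLaw, one_mul]
      _ ≤ _ := by
          push_cast
          linarith

theorem sum_unionLaw_touching_le {t : ℝ} (ht : t ∈ Set.Icc (0 : ℝ) 1) (i : ℕ)
    {H : Finset (Finset V)} {d : Finset V → ℝ} {r : ℕ} (hr : ∀ A ∈ H, #A = r)
    (hd : ∀ A ∈ H, 0 < d A) :
    ∑ W, unionLaw t i W * ∑ A ∈ H, (if Disjoint A W then 0 else d A) ≤ r * (i * t) * eTot H d := by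
  simp_rw [mul_sum]
  rw [sum_comm, eTot, mul_sum]
  refine sum_le_sum fun A hA => ?_
  calc _ ≤ ∑ W, ∑ v ∈ A, d A * (unionLaw t i W * if v ∈ W then 1 else 0) := by
        refine sum_le_sum fun W _ => ?_
        rw [← mul_sum, ← mul_sum, mul_left_comm]
        refine mul_le_mul_of_nonneg_left ?_ (unionLaw_nonneg ht i W)
        have h0 : ∀ v ∈ A, (0 : ℝ) ≤ if v ∈ W then 1 else 0 := fun v _ => by positivity
        split_ifs with h
        · exact mul_nonneg (hd A hA).le (sum_nonneg h0)
        · obtain ⟨v, hv, hvW⟩ := not_disjoint_iff.1 h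
          refine le_mul_of_one_le_right (hd A hA).le ?_
          exact le_trans (by simp [hvW]) (single_le_sum h0 hv)
    _ ≤ ∑ _v ∈ A, d A * (i * t) := by
        rw [sum_comm]
        refine sum_le_sum fun v _ => ?_
        rw [← mul_sum]
        exact mul_le_mul_of_nonneg_left (sum_unionLaw_mem_le ht i v) (hd A hA).le
    _ = _ := by
        rw [sum_const, nsmul_eq_mul, hr A hA]
        ring

/-! ### Telescoping products over edges -/

theorem exists_telescoping (V : Type*) [Fintype V] [DecidableEq V] :
    ∃ lo hi : Finset V → V → Finset V,
      (∀ A, ∀ v ∈ A, Disjoint (lo A v) (hi A v) ∧ lo A v ∪ hi A v = A.erase v) ∧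
      ∀ A (f g : V → ℝ), ∏ v ∈ A, f v - ∏ v ∈ A, g v =
        ∑ v ∈ A, (f v - g v) * (∏ u ∈ lo A v, g u) * ∏ u ∈ hi A v, f u := by
  let _ : LinearOrder V := LinearOrder.lift' (Fintype.equivFin V) (Fintype.equivFin V).injective
  refine ⟨fun A v => {u ∈ A | u < v}, fun A v => {u ∈ A | v < u}, fun A v _ => ⟨?_, ?_⟩,
    fun A f g => ?_⟩
  · rw [disjoint_left]
    intro u hu hu'
    exact lt_asymm (mem_filter.1 hu).2 (mem_filter.1 hu').2
  · ext u
    rw [mem_union, mem_filter, mem_filter, mem_erase, ← and_or_left, ← ne_iff_lt_or_gt, and_comm]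
  · have h := prod_sub_ordered A f (fun v => f v - g v)
    simp only [sub_sub_cancel] at h
    linarith

/-! ### Second moments of link counts -/

theorem sum_sq_link_le {μ : Finset V → ℝ} {p t : ℝ} (hp : 0 ≤ p) (ht : t ∈ Set.Icc (0 : ℝ) 1)
    (hμ1 : ∑ ω, μ ω = 1)
    (hμp : ∀ v ω, v ∉ ω → (1 - p) * μ (insert v ω) ≤ p * μ ω) (S : Finset (Finset V))
    {c : Finset V → ℝ} (hc : ∀ A ∈ S, 0 ≤ c A) (lo : Finset V → Finset V) :
    ∑ U, pw (fun _ => t) U * ∑ ω, μ ω *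
        (∑ A ∈ S, c A * if lo A ⊆ U ∧ lo A ⊆ ω then 1 else 0) ^ 2 ≤
      ∑ A ∈ S, ∑ A' ∈ S, c A * c A' * (t * p) ^ #(lo A ∪ lo A') := by
  have h1 : ∀ U ω : Finset V, (∑ A ∈ S, c A * if lo A ⊆ U ∧ lo A ⊆ ω then 1 else 0) ^ 2 =
      ∑ A ∈ S, ∑ A' ∈ S, c A * c A' * ((if lo A ∪ lo A' ⊆ U then 1 else 0) *
        if lo A ∪ lo A' ⊆ ω then 1 else 0) := by
    intro U ω
    rw [sq, sum_mul_sum]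
    refine sum_congr rfl fun A _ => sum_congr rfl fun A' _ => ?_
    simp only [union_subset_iff]
    by_cases a : lo A ⊆ U <;> by_cases b : lo A ⊆ ω <;> by_cases a' : lo A' ⊆ U <;>
      by_cases b' : lo A' ⊆ ω <;> simp [a, b, a', b']
  calc _ = ∑ A ∈ S, ∑ A' ∈ S, c A * c A' *
        ((∑ U, pw (fun _ => t) U * (if lo A ∪ lo A' ⊆ U then 1 else 0)) *
          ∑ ω, μ ω * if lo A ∪ lo A' ⊆ ω then 1 else 0) := by
        simp_rw [h1, mul_sum]
        rw [sum_congr rfl fun U _ => sum_comm, sum_comm]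
        refine sum_congr rfl fun A _ => ?_
        rw [sum_congr rfl fun U _ => sum_comm, sum_comm]
        refine sum_congr rfl fun A' _ => ?_
        rw [← mul_sum, ← mul_sum, sum_mul_sum, mul_sum]
        refine sum_congr rfl fun U _ => ?_
        rw [mul_sum]
        exact sum_congr rfl fun ω _ => by ring
    _ ≤ _ := by
        refine sum_le_sum fun A hA => sum_le_sum fun A' hA' => ?_
        refine mul_le_mul_of_nonneg_left ?_ (mul_nonneg (hc A hA) (hc A' hA'))
        rw [sum_pw_subset, prod_const, mul_pow]
        exact mul_le_mul_of_nonneg_left (sum_subset_le_pow hp hμ1 hμp _) (pow_nonneg ht.1 _)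

omit [Fintype V] in
theorem sum_link_pairs_le {H : Finset (Finset V)} {d : Finset V → ℝ} {r : ℕ} {x D : ℝ}
    (hr : ∀ A ∈ H, #A = r) (hd : ∀ A ∈ H, 0 < d A) (hx : 0 < x) (hD : 0 ≤ D)
    (hdeg : ∀ B : Finset V, 1 ≤ #B → #B ≤ r → degH H d B ≤ D * x ^ (#B - 1)) (v : V)
    {lo : Finset V → Finset V} (hlo : ∀ A, v ∈ A → lo A ⊆ A.erase v) :
    ∑ A ∈ H with v ∈ A, ∑ A' ∈ H with v ∈ A', d A * d A' / x ^ #(lo A ∩ lo A') ≤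
      2 ^ r * D ^ 2 := by
  have hA : ∀ A ∈ H.filter (v ∈ ·), ∑ A' ∈ H with v ∈ A', d A' / x ^ #(lo A ∩ lo A') ≤
      2 ^ r * D := by
    intro A hA
    rw [mem_filter] at hA
    have hcard : #(A.erase v) + 1 = r := by rw [card_erase_add_one hA.2, hr A hA.1]
    calc _ ≤ ∑ A' ∈ H with v ∈ A', ∑ J ∈ (A.erase v).powerset,
          (if J ⊆ A' then d A' / x ^ #J else 0) := by
          refine sum_le_sum fun A' hA' => ?_
          rw [mem_filter] at hA'
          have hJ : lo A ∩ lo A' ⊆ A' :=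
            inter_subset_right.trans ((hlo A' hA'.2).trans (erase_subset _ _))
          have h := single_le_sum (s := (A.erase v).powerset)
            (f := fun J => if J ⊆ A' then d A' / x ^ #J else 0)
            (fun J _ => by
              have := (hd A' hA'.1).le
              positivity)
            (mem_powerset.2 (inter_subset_left.trans (hlo A hA.2)) :
              lo A ∩ lo A' ∈ (A.erase v).powerset)
          simpa only [hJ, if_true] using h
      _ = ∑ J ∈ (A.erase v).powerset, degH H d (insert v J) / x ^ #J := by
          rw [sum_comm]
          refine sum_congr rfl fun J _ => ?_
          rw [degH, sum_div, sum_filter]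
          refine sum_congr rfl fun A' _ => ?_
          simp only [insert_subset_iff]
          by_cases h1 : v ∈ A' <;> by_cases h2 : J ⊆ A' <;> simp [h1, h2]
      _ ≤ ∑ _J ∈ (A.erase v).powerset, D := by
          refine sum_le_sum fun J hJ => ?_
          have hJ' := mem_powerset.1 hJ
          have hv : v ∉ J := fun h => by simpa using hJ' h
          have hle := card_le_card hJ'
          have hJc : #(insert v J) = #J + 1 := card_insert_of_notMem hv
          rw [div_le_iff₀ (by positivity)]
          have h := hdeg (insert v J) (by omega) (by omega)
          rwa [hJc, Nat.add_sub_cancel] at h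
      _ ≤ 2 ^ r * D := by
          rw [sum_const, card_powerset, nsmul_eq_mul]
          push_cast
          refine mul_le_mul_of_nonneg_right (pow_le_pow_right₀ one_le_two (by omega)) hD
  calc _ ≤ ∑ A ∈ H with v ∈ A, d A * (2 ^ r * D) := by
        refine sum_le_sum fun A h => ?_
        simp_rw [mul_div_assoc]
        rw [← mul_sum]
        exact mul_le_mul_of_nonneg_left (hA A h) (hd A (mem_filter.1 h).1).le
    _ ≤ D * (2 ^ r * D) := by
        rw [← sum_mul]
        refine mul_le_mul_of_nonneg_right ?_ (by positivity)
        rcases (H.filter (v ∈ ·)).eq_empty_or_nonempty with h | ⟨A, h⟩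
        · simpa [h] using hD
        · have h' := mem_filter.1 h
          have hr1 : 1 ≤ r := hr A h'.1 ▸ card_pos.2 ⟨v, h'.2⟩
          simpa [degH, sum_filter] using hdeg {v} (by simp) (by simpa using hr1)
    _ = _ := by ring

theorem sum_sq_weighted_link_le {μ : Finset V → ℝ} {H : Finset (Finset V)} {d : Finset V → ℝ}
    {r : ℕ} {p t D : ℝ} (hp : 0 < p) (ht : 0 < t) (ht1 : t ≤ 1 / 2) (hμ1 : ∑ ω, μ ω = 1)
    (hμp : ∀ v ω, v ∉ ω → (1 - p) * μ (insert v ω) ≤ p * μ ω)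
    (hr : ∀ A ∈ H, #A = r) (hd : ∀ A ∈ H, 0 < d A) (hD : 0 ≤ D)
    (hdeg : ∀ B : Finset V, 1 ≤ #B → #B ≤ r → degH H d B ≤ D * (t * p) ^ (#B - 1)) (v : V)
    {lo : Finset V → Finset V} (hlo : ∀ A, v ∈ A → lo A ⊆ A.erase v) :
    ∑ U, pw (fun _ => t) U * ∑ ω, μ ω *
        (∑ A ∈ H with v ∈ A, d A * p ^ (r - 1) / ((t * p) ^ #(lo A) * (1 - t)) *
          if lo A ⊆ U ∧ lo A ⊆ ω then 1 else 0) ^ 2 ≤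
      4 * 2 ^ r * (D * p ^ (r - 1)) ^ 2 := by
  have hx : 0 < t * p := mul_pos ht hp
  have ht0 : 0 < 1 - t := by linarith
  refine (sum_sq_link_le hp.le ⟨ht.le, by linarith⟩ hμ1 hμp _ (fun A hA => ?_) lo).trans ?_
  · have := hd A (mem_filter.1 hA).1
    positivity
  calc _ = (p ^ (r - 1) / (1 - t)) ^ 2 *
        ∑ A ∈ H with v ∈ A, ∑ A' ∈ H with v ∈ A', d A * d A' / (t * p) ^ #(lo A ∩ lo A') := by
        simp_rw [mul_sum]
        refine sum_congr rfl fun A _ => sum_congr rfl fun A' _ => ?_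
        have h : (t * p) ^ #(lo A ∪ lo A') * (t * p) ^ #(lo A ∩ lo A') =
            (t * p) ^ #(lo A) * (t * p) ^ #(lo A') := by
          rw [← pow_add, ← pow_add, card_union_add_card_inter]
        have h1 : (t * p) ^ #(lo A ∪ lo A') =
            (t * p) ^ #(lo A) * (t * p) ^ #(lo A') / (t * p) ^ #(lo A ∩ lo A') := by
          rw [← h, mul_div_cancel_right₀ _ (pow_ne_zero _ hx.ne')]
        rw [h1]
        have h2 := (pow_pos hx #(lo A)).ne'
        have h3 := (pow_pos hx #(lo A')).ne'
        have h4 := (pow_pos hx #(lo A ∩ lo A')).ne'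
        generalize (t * p) ^ #(lo A) = a at *
        generalize (t * p) ^ #(lo A') = b at *
        generalize (t * p) ^ #(lo A ∩ lo A') = c at *
        field_simp
    _ ≤ (p ^ (r - 1) * 2) ^ 2 * (2 ^ r * D ^ 2) := by
        gcongr
        · refine sum_nonneg fun A hA => sum_nonneg fun A' hA' => ?_
          have h1 := hd A (mem_filter.1 hA).1
          have h2 := hd A' (mem_filter.1 hA').1
          positivity
        · rw [div_le_iff₀ ht0]
          have : 0 < p ^ (r - 1) := by positivity
          nlinarith
        · exact sum_link_pairs_le hr hd hx hD hdeg v hlo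
    _ = _ := by ring

/-! ### Comparing the conditional edge count with its product surrogate -/

theorem sum_conditional_error_le {μ : Finset V → ℝ} {H : Finset (Finset V)} {d : Finset V → ℝ}
    {r : ℕ} {p t D s : ℝ} (hp : 0 < p) (ht : 0 < t) (ht1 : t ≤ 1 / 2) (hs : 0 < s)
    (hμ : ∀ ω, 0 ≤ μ ω) (hμ1 : ∑ ω, μ ω = 1)
    (hμp : ∀ v ω, v ∉ ω → (1 - p) * μ (insert v ω) ≤ p * μ ω)
    (hr : ∀ A ∈ H, #A = r) (hd : ∀ A ∈ H, 0 < d A) (hD : 0 ≤ D)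
    (hdeg : ∀ B : Finset V, 1 ≤ #B → #B ≤ r → degH H d B ≤ D * (t * p) ^ (#B - 1))
    {W : Finset V} {σ : Finset V → ℝ} (hσ : DependsOnTrace W σ) (hσ1 : ∀ ω, |σ ω| ≤ 1) :
    ∑ ω, μ ω * (σ ω * ∑ A ∈ H with Disjoint A W,
        d A * (∏ v ∈ A, cP μ W v ω - if A ⊆ ω then 1 else 0)) ≤
      s / 2 * ∑ U, pw (fun _ => t) U * ∑ v, ∑ ω, μ ω *
        (cP μ (W.erase v) v ω - cP μ ((W ∪ U).erase v) v ω) ^ 2 +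
      (Fintype.card V : ℝ) * (4 * 2 ^ r * (D * p ^ (r - 1)) ^ 2 / (2 * s)) := by
  obtain ⟨lo, hi, hlohi, htel⟩ := exists_telescoping V
  have ht0 : 0 < 1 - t := by linarith
  have hlo : ∀ v A, v ∈ A → lo A v ⊆ A.erase v := fun v A hv =>
    (hlohi A v hv).2 ▸ subset_union_left
  have hvlo : ∀ v A, v ∈ A → v ∉ lo A v := fun v A hv h => by simpa using hlo v A hv h
  have hhi : ∀ v A, v ∈ A → hi A v ⊆ A.erase v := fun v A hv =>
    (hlohi A v hv).2 ▸ subset_union_right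
  set κ : Finset V → V → ℝ := fun A v => (t ^ #(lo A v) * (1 - t))⁻¹ with hκ
  have hκ0 : ∀ A v, 0 < κ A v := fun A v => by simp only [hκ]; positivity
  set N : Finset V → V → Finset V → ℝ := fun U v ω => ∑ A ∈ H with Disjoint A W ∧ v ∈ A,
    d A * κ A v * (if lo A v ⊆ U ∧ lo A v ⊆ ω then 1 else 0) *
      ∏ u ∈ hi A v, cP μ W u ω with hN
  set N' : Finset V → V → Finset V → ℝ := fun U v ω => ∑ A ∈ H with v ∈ A,
    d A * p ^ (r - 1) / ((t * p) ^ #(lo A v) * (1 - t)) *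
      if lo A v ⊆ U ∧ lo A v ⊆ ω then 1 else 0 with hN'
  have hcP0 := cP_nonneg hμ W
  have hNnn : ∀ U v ω, 0 ≤ N U v ω := fun U v ω => sum_nonneg fun A hA => by
    have h1 := (hd A (mem_filter.1 hA).1).le
    have h2 := (hκ0 A v).le
    have h3 : 0 ≤ ∏ u ∈ hi A v, cP μ W u ω := prod_nonneg fun u _ => hcP0 u ω
    positivity
  have hNN' : ∀ U v ω, N U v ω ≤ N' U v ω := by
    intro U v ω
    refine (sum_le_sum fun A hA => ?_).trans (sum_le_sum_of_subset_of_nonneg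
      (fun A hA => ?_ : (H.filter fun A => Disjoint A W ∧ v ∈ A) ⊆ H.filter (v ∈ ·))
      fun A hA _ => ?_)
    · obtain ⟨hAH, hAW, hvA⟩ := mem_filter.1 hA
      have hprod : ∏ u ∈ hi A v, cP μ W u ω ≤ p ^ #(hi A v) := by
        rw [← prod_const]
        refine prod_le_prod (fun u _ => hcP0 u ω) fun u hu => ?_
        exact cP_le hp.le hμ hμp
          (disjoint_left.1 hAW (mem_of_mem_erase (hhi v A hvA hu))) ω
      have hcard : #(hi A v) + #(lo A v) = r - 1 := by
        rw [add_comm, ← card_union_of_disjoint (hlohi A v hvA).1, (hlohi A v hvA).2,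
          card_erase_of_mem hvA, hr A hAH]
      have hpow : p ^ (r - 1) / ((t * p) ^ #(lo A v) * (1 - t)) = κ A v * p ^ #(hi A v) := by
        simp only [hκ]
        rw [← hcard, pow_add, mul_pow]
        field_simp
      have h1 := (hd A hAH).le
      have h2 := (hκ0 A v).le
      rw [mul_div_assoc, hpow]
      calc _ ≤ d A * κ A v * (if lo A v ⊆ U ∧ lo A v ⊆ ω then 1 else 0) * p ^ #(hi A v) := by
            gcongr
        _ = _ := by ring
    · rw [mem_filter] at hA ⊢
      exact ⟨hA.1, hA.2.2⟩
    · have h1 := (hd A (mem_filter.1 hA).1).le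
      positivity
  have hNdep : ∀ U v, DependsOnTrace (W ∪ U) (N U v) := by
    intro U v ω ω' h
    have hW : ω ∩ W = ω' ∩ W := by
      have := congrArg (· ∩ W) h
      simpa [inter_assoc] using this
    have hU : ω ∩ U = ω' ∩ U := by
      have := congrArg (· ∩ U) h
      simpa [inter_assoc] using this
    refine sum_congr rfl fun A _ => ?_
    have h1 : (lo A v ⊆ U ∧ lo A v ⊆ ω) ↔ (lo A v ⊆ U ∧ lo A v ⊆ ω') := by
      rw [← subset_inter_iff, ← subset_inter_iff, inter_comm U, inter_comm U, hU]
    have h2 : ∀ u, cP μ W u ω = cP μ W u ω' := fun u => dependsOnTrace_cP μ W u ω ω' hW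
    simp only [h1, h2]
  -- insert an auxiliary random set containing `lo A v` and avoiding `v`
  have hexp : ∑ ω, μ ω * (σ ω * ∑ A ∈ H with Disjoint A W,
      d A * (∏ v ∈ A, cP μ W v ω - if A ⊆ ω then 1 else 0)) =
      ∑ U, pw (fun _ => t) U * ∑ v, if v ∈ W ∪ U then 0 else
        ∑ ω, μ ω * (σ ω * N U v ω * (cP μ W v ω - if v ∈ ω then 1 else 0)) := by
    have hT : ∀ ω A, Disjoint A W →
        ∏ v ∈ A, cP μ W v ω - (if A ⊆ ω then (1 : ℝ) else 0) =
        ∑ U, pw (fun _ => t) U * ∑ v ∈ A, if v ∈ W ∪ U then 0 else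
          κ A v * (if lo A v ⊆ U ∧ lo A v ⊆ ω then 1 else 0) *
            (∏ u ∈ hi A v, cP μ W u ω) * (cP μ W v ω - if v ∈ ω then 1 else 0) := by
      intro ω A hAW
      have hind : ∀ S : Finset V, (if S ⊆ ω then (1 : ℝ) else 0) =
          ∏ v ∈ S, if v ∈ ω then 1 else 0 := by
        intro S
        rw [prod_ite_zero, prod_const_one]
        rfl
      rw [hind, htel]
      simp_rw [mul_sum]
      rw [sum_comm]
      refine sum_congr rfl fun v hv => ?_
      have hvW : v ∉ W := disjoint_left.1 hAW hv
      have hU := sum_pw_subset_notMem (fun _ : V => t) (hvlo v A hv)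
      rw [prod_const] at hU
      rw [← hind]
      calc _ = (t ^ #(lo A v) * (1 - t)) * (κ A v * ((if lo A v ⊆ ω then 1 else 0) *
              (∏ u ∈ hi A v, cP μ W u ω) * (cP μ W v ω - if v ∈ ω then 1 else 0))) := by
            rw [← mul_assoc (t ^ #(lo A v) * (1 - t)), hκ, mul_inv_cancel₀ (by positivity)]
            ring
        _ = _ := by
            rw [← hU, sum_mul]
            refine sum_congr rfl fun U _ => ?_
            by_cases h1 : v ∈ U <;> by_cases h2 : lo A v ⊆ U <;> simp [h1, h2, hvW]
            ring_nf
    calc _ = ∑ ω, ∑ U, ∑ A ∈ H, ∑ v, pw (fun _ => t) U * (μ ω * (σ ω *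
            if Disjoint A W ∧ v ∈ A ∧ v ∉ W ∪ U then d A * κ A v *
              (if lo A v ⊆ U ∧ lo A v ⊆ ω then 1 else 0) * (∏ u ∈ hi A v, cP μ W u ω) *
              (cP μ W v ω - if v ∈ ω then 1 else 0) else 0)) := by
          refine sum_congr rfl fun ω _ => ?_
          rw [sum_filter, mul_sum, mul_sum, sum_comm]
          refine sum_congr rfl fun A _ => ?_
          by_cases hAW : Disjoint A W
          · simp only [hAW, if_true, true_and]
            rw [hT ω A hAW, mul_sum, mul_sum, mul_sum]
            refine sum_congr rfl fun U _ => ?_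
            rw [← mul_sum, ← mul_sum, ← mul_sum, ← sum_subset (subset_univ A)]
            · rw [mul_left_comm (d A), mul_left_comm (σ ω), mul_left_comm (μ ω), mul_sum]
              congr 3
              refine sum_congr rfl fun v hv => ?_
              by_cases h : v ∈ W ∪ U
              · simp [h]
              · simp only [h, hv, if_false, not_false_eq_true, and_self, if_true]
                ring
            · intro v _ hv
              simp [hv]
          · simp [hAW]
      _ = _ := by
          rw [sum_comm]
          refine sum_congr rfl fun U _ => ?_
          rw [sum_congr rfl fun ω _ => sum_comm, sum_comm, mul_sum]
          refine sum_congr rfl fun v _ => ?_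
          by_cases h : v ∈ W ∪ U
          · simp [h]
          · simp only [h, not_false_eq_true, and_true, if_false]
            rw [mul_sum]
            refine sum_congr rfl fun ω _ => ?_
            simp only [hN]
            rw [← mul_sum, ← mul_sum, ← mul_sum, ← sum_filter, mul_assoc (σ ω), sum_mul]
  have hpt : ∀ U v, (if v ∈ W ∪ U then 0 else
      ∑ ω, μ ω * (σ ω * N U v ω * (cP μ W v ω - if v ∈ ω then 1 else 0))) ≤
      s / 2 * ∑ ω, μ ω * (cP μ (W.erase v) v ω - cP μ ((W ∪ U).erase v) v ω) ^ 2 +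
        (∑ ω, μ ω * N' U v ω ^ 2) / (2 * s) := by
    intro U v
    split_ifs with hv
    · refine add_nonneg (mul_nonneg (by positivity) (sum_nonneg fun ω _ => ?_))
        (div_nonneg (sum_nonneg fun ω _ => ?_) (by positivity))
      · exact mul_nonneg (hμ ω) (sq_nonneg _)
      · exact mul_nonneg (hμ ω) (sq_nonneg _)
    · have hvW : v ∉ W := fun h => hv (mem_union_left _ h)
      rw [erase_eq_of_notMem hvW, erase_eq_of_notMem hv]
      have h1 := sum_mul_cP hμ v ((hσ.mono (subset_union_left (s₂ := U))).mul (hNdep U v))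
      have h2 : ∑ ω, μ ω * (σ ω * N U v ω * (cP μ W v ω - if v ∈ ω then 1 else 0)) =
          ∑ ω, μ ω * (σ ω * N U v ω * (cP μ W v ω - cP μ (W ∪ U) v ω)) := by
        simp_rw [mul_sub]
        rw [sum_sub_distrib, sum_sub_distrib, h1]
      rw [h2, mul_sum, sum_div, ← sum_add_distrib]
      refine sum_le_sum fun ω _ => ?_
      set x := cP μ W v ω - cP μ (W ∪ U) v ω with hx
      set y := σ ω * N U v ω with hy
      have hy2 : y ^ 2 ≤ N' U v ω ^ 2 := by
        rw [sq_le_sq, hy, abs_mul, abs_of_nonneg (hNnn U v ω)]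
        exact (mul_le_of_le_one_left (hNnn U v ω) (hσ1 ω)).trans
          ((hNN' U v ω).trans (le_abs_self _))
      have hxy : y * x ≤ s / 2 * x ^ 2 + N' U v ω ^ 2 / (2 * s) := by
        have h3 : y * x ≤ s / 2 * x ^ 2 + y ^ 2 / (2 * s) := by
          have : s / 2 * x ^ 2 + y ^ 2 / (2 * s) - y * x = (s * x - y) ^ 2 / (2 * s) := by
            field_simp
            ring
          have : 0 ≤ (s * x - y) ^ 2 / (2 * s) := by positivity
          linarith
        exact h3.trans (by gcongr)
      calc _ ≤ μ ω * (s / 2 * x ^ 2 + N' U v ω ^ 2 / (2 * s)) :=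
            mul_le_mul_of_nonneg_left hxy (hμ ω)
        _ = _ := by ring
  rw [hexp]
  calc _ ≤ ∑ U, pw (fun _ => t) U * ∑ v,
        (s / 2 * ∑ ω, μ ω * (cP μ (W.erase v) v ω - cP μ ((W ∪ U).erase v) v ω) ^ 2 +
          (∑ ω, μ ω * N' U v ω ^ 2) / (2 * s)) :=
        sum_le_sum fun U _ => mul_le_mul_of_nonneg_left (sum_le_sum fun v _ => hpt U v)
          (pw_nonneg (fun _ => ⟨ht.le, by linarith⟩) U)
    _ = s / 2 * ∑ U, pw (fun _ => t) U * ∑ v, ∑ ω, μ ω *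
        (cP μ (W.erase v) v ω - cP μ ((W ∪ U).erase v) v ω) ^ 2 +
        ∑ v, (∑ U, pw (fun _ => t) U * ∑ ω, μ ω * N' U v ω ^ 2) / (2 * s) := by
        simp_rw [sum_add_distrib, mul_add]
        rw [sum_add_distrib]
        congr 1
        · rw [mul_sum]
          refine sum_congr rfl fun U _ => ?_
          rw [← mul_sum]
          ring
        · simp_rw [← sum_div]
          rw [sum_comm' (t' := univ) (s' := fun _ => univ) (by simp), sum_div]
          refine sum_congr rfl fun U _ => ?_
          rw [← mul_sum]
          ring
    _ ≤ _ := by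
        gcongr
        rw [← nsmul_eq_mul, ← card_univ, ← sum_const]
        refine sum_le_sum fun v _ => ?_
        gcongr
        exact sum_sq_weighted_link_le hp ht ht1 hμ1 hμp hr hd hD hdeg v (hlo v)

theorem exists_small_increment {μ : Finset V → ℝ} {p t : ℝ} (hp : 0 ≤ p)
    (ht : t ∈ Set.Icc (0 : ℝ) 1) (hμ : ∀ ω, 0 ≤ μ ω) (hμ1 : ∑ ω, μ ω = 1)
    (hμp : ∀ v ω, v ∉ ω → (1 - p) * μ (insert v ω) ≤ p * μ ω) {m : ℕ} (hm : 0 < m) :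
    ∃ i < m, ∑ W, unionLaw t i W * ∑ U, pw (fun _ => t) U * ∑ v, ∑ ω, μ ω *
        (cP μ (W.erase v) v ω - cP μ ((W ∪ U).erase v) v ω) ^ 2 ≤
      (Fintype.card V : ℝ) * p ^ 2 / m := by
  set h : Finset V → ℝ := fun W => ∑ v, ∑ ω, μ ω * cP μ (W.erase v) v ω ^ 2 with hh
  set a : ℕ → ℝ := fun i => ∑ W, unionLaw t i W * h W with ha
  have h0 : ∀ W, 0 ≤ h W := fun W =>
    sum_nonneg fun v _ => sum_nonneg fun ω _ => mul_nonneg (hμ ω) (sq_nonneg _)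
  have h1 : ∀ W, h W ≤ Fintype.card V * p ^ 2 := by
    intro W
    calc _ ≤ ∑ _v : V, ∑ ω, μ ω * p ^ 2 := by
          refine sum_le_sum fun v _ => sum_le_sum fun ω _ => ?_
          refine mul_le_mul_of_nonneg_left ?_ (hμ ω)
          exact pow_le_pow_left₀ (cP_nonneg hμ _ _ _) (cP_le hp hμ hμp (notMem_erase v W) ω) 2
      _ = _ := by
          rw [← sum_mul, hμ1, one_mul, sum_const, card_univ, nsmul_eq_mul]
  have hinc : ∀ i, ∑ W, unionLaw t i W * ∑ U, pw (fun _ => t) U * ∑ v, ∑ ω, μ ω *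
        (cP μ (W.erase v) v ω - cP μ ((W ∪ U).erase v) v ω) ^ 2 = a (i + 1) - a i := by
    intro i
    simp only [ha]
    rw [sum_unionLaw_succ, ← sum_sub_distrib]
    refine sum_congr rfl fun W _ => ?_
    rw [← mul_sub]
    congr 1
    calc _ = ∑ U, pw (fun _ => t) U * (h (W ∪ U) - h W) := by
          refine sum_congr rfl fun U _ => ?_
          simp only [hh]
          rw [← sum_sub_distrib]
          congr 1
          exact sum_congr rfl fun v _ =>
            sum_sq_cP_sub hμ (erase_subset_erase v subset_union_left) v
      _ = _ := by
          simp_rw [mul_sub]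
          rw [sum_sub_distrib, ← sum_mul, sum_pw, one_mul]
  obtain ⟨i, hi, hle⟩ := exists_le_of_sum_le (s := range m) (f := fun i => a (i + 1) - a i)
    (g := fun _ => (Fintype.card V : ℝ) * p ^ 2 / m) (nonempty_range_iff.2 hm.ne') (by
      rw [sum_range_sub, sum_const, card_range, nsmul_eq_mul,
        mul_div_cancel₀ _ (Nat.cast_ne_zero.2 hm.ne')]
      have h2 : a m ≤ ∑ W, unionLaw t m W * (Fintype.card V * p ^ 2) :=
        sum_le_sum fun W _ => mul_le_mul_of_nonneg_left (h1 W) (unionLaw_nonneg ht m W)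
      rw [← sum_mul, sum_unionLaw, one_mul] at h2
      have h3 : 0 ≤ a 0 := sum_nonneg fun W _ => mul_nonneg (unionLaw_nonneg ht 0 W) (h0 W)
      linarith)
  exact ⟨i, mem_range.1 hi, (hinc i).trans_le hle⟩

/-! ### The variational problem -/

theorem sub_le_mul_log_div {x y : ℝ} (hx : 0 ≤ x) (hy : 0 < y) :
    x - y ≤ x * Real.log (x / y) := by
  rcases hx.eq_or_lt with rfl | hx
  · simpa using hy.le
  · have h := Real.log_le_sub_one_of_pos (div_pos hy hx)
    rw [← inv_div, Real.log_inv] at h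
    have h2 := mul_le_mul_of_nonneg_left h hx.le
    rw [mul_sub, inv_div, mul_div_cancel₀ _ hx.ne'] at h2
    linarith

theorem ip_nonneg {p q : ℝ} (hp : 0 < p) (hp1 : p < 1) (hq : q ∈ Set.Icc (0 : ℝ) 1) :
    0 ≤ ip p q := by
  have h1 := sub_le_mul_log_div hq.1 hp
  have h2 := sub_le_mul_log_div (sub_nonneg.2 hq.2) (sub_pos.2 hp1)
  rw [ip]
  linarith

theorem ip_self {p : ℝ} (hp : 0 < p) (hp1 : p < 1) : ip p p = 0 := by
  rw [ip, div_self hp.ne', div_self (sub_pos.2 hp1).ne']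
  simp

theorem PhiH_nonneg (H : Finset (Finset V)) (d : Finset V → ℝ) {p : ℝ} (hp : 0 < p) (hp1 : p < 1)
    (η : ℝ) : 0 ≤ PhiH H d p η := by
  refine Real.sInf_nonneg ?_
  rintro x ⟨q, hq, -, rfl⟩
  exact sum_nonneg fun v _ => ip_nonneg hp hp1 (hq v)

theorem PhiH_le {H : Finset (Finset V)} {d : Finset V → ℝ} {p : ℝ} (hp : 0 < p) (hp1 : p < 1)
    {η : ℝ} {q : V → ℝ} (hq : ∀ v, q v ∈ Set.Icc (0 : ℝ) 1)
    (h : expE H d q ≤ η * expE H d fun _ => p) : PhiH H d p η ≤ ∑ v, ip p (q v) := by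
  refine csInf_le ⟨0, ?_⟩ ⟨q, hq, h, rfl⟩
  rintro x ⟨q', hq', -, rfl⟩
  exact sum_nonneg fun v _ => ip_nonneg hp hp1 (hq' v)

theorem expE_const {H : Finset (Finset V)} {d : Finset V → ℝ} {r : ℕ} (hr : ∀ A ∈ H, #A = r)
    (p : ℝ) : expE H d (fun _ => p) = p ^ r * eTot H d := by
  rw [expE_eq, eTot, mul_sum]
  exact sum_congr rfl fun A hA => by rw [prod_const, hr A hA, mul_comm]

omit [Fintype V] in
theorem eInd_mono {H : Finset (Finset V)} {d : Finset V → ℝ} (hd : ∀ A ∈ H, 0 < d A)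
    {ω ω' : Finset V} (h : ω ⊆ ω') : eInd H d ω ≤ eInd H d ω' := by
  refine sum_le_sum fun A hA => ?_
  have := (hd A hA).le
  by_cases h1 : A ⊆ ω
  · simp [h1, h1.trans h]
  · rw [if_neg h1]
    positivity

/-- If revealing the trace on a typical set drawn from `ρ` leaves the remaining vertices nearly
independent (in the sense of `herr`), the lower tail is governed by product measures. -/
theorem one_sub_mul_PhiH_le {H : Finset (Finset V)} {d : Finset V → ℝ} {r : ℕ} {p η ε δ₁ δ₂ : ℝ}
    (hp : 0 < p) (hp1 : p < 1) (hη : 0 ≤ η) (hε : 0 < ε) (hr : ∀ A ∈ H, #A = r)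
    (hd : ∀ A ∈ H, 0 < d A) (hE : 0 < expE H d fun _ => p) {P : ℝ}
    (hP : P = lowPr H d p η) (hP0 : 0 < P) {μ : Finset V → ℝ}
    (hμ : μ = fun ω =>
      (if eInd H d ω ≤ η * expE H d (fun _ => p) then pw (fun _ => p) ω else 0) / P)
    (hμp : ∀ v ω, v ∉ ω → (1 - p) * μ (insert v ω) ≤ p * μ ω)
    {ρ : Finset V → ℝ} (hρ : ∀ W, 0 ≤ ρ W) (hρ1 : ∑ W, ρ W = 1)
    (htouch : ∑ W, ρ W * ∑ A ∈ H, (if Disjoint A W then 0 else d A) ≤ δ₁ * eTot H d)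
    (herr : ∀ σ : Finset V → Finset V → ℝ, (∀ W, DependsOnTrace W (σ W)) →
      (∀ W ω, |σ W ω| ≤ 1) → ∑ W, ρ W * ∑ ω, μ ω * (σ W ω * ∑ A ∈ H with Disjoint A W,
        d A * (∏ v ∈ A, cP μ W v ω - if A ⊆ ω then 1 else 0)) ≤ δ₂ * expE H d fun _ => p) :
    (1 - (δ₁ + δ₂) / ε) * PhiH H d p (η + ε) ≤ -Real.log P := by
  have hπ : ∀ ω : Finset V, 0 ≤ pw (fun _ => p) ω := pw_nonneg fun _ => ⟨hp.le, hp1.le⟩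
  have hμ0 : ∀ ω, 0 ≤ μ ω := fun ω => by
    rw [hμ]
    have := hπ ω
    positivity
  have hμ1 : ∑ ω, μ ω = 1 := by
    rw [hμ, ← sum_div, div_eq_one_iff_eq hP0.ne', hP, lowPr]
  set E := expE H d fun _ => p with hEdef
  have hEeq : E = p ^ r * eTot H d := expE_const hr p
  set Φ := PhiH H d p (η + ε) with hΦ
  have hΦ0 : 0 ≤ Φ := PhiH_nonneg H d hp hp1 _
  set X : Finset V → Finset V → ℝ := fun W ω =>
    ∑ A ∈ H with Disjoint A W, d A * if A ⊆ ω then 1 else 0 with hX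
  set F : Finset V → Finset V → ℝ := fun W ω =>
    ∑ A ∈ H with Disjoint A W, d A * ∏ v ∈ A, cP μ W v ω with hF
  set T : Finset V → ℝ := fun W => ∑ A ∈ H, if Disjoint A W then 0 else d A with hT
  set σ : Finset V → Finset V → ℝ := fun W ω =>
    if 0 ≤ F W ω - cE μ W (X W) ω then 1 else 0 with hσ
  have hFdep : ∀ W, DependsOnTrace W (F W) := by
    intro W ω ω' h
    have h2 : ∀ u, cP μ W u ω = cP μ W u ω' := fun u => dependsOnTrace_cP μ W u ω ω' h
    simp only [hF, h2]
  have hσdep : ∀ W, DependsOnTrace W (σ W) := by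
    intro W ω ω' h
    simp only [hσ, hFdep W ω ω' h, dependsOnTrace_cE μ W (X W) ω ω' h]
  have hXle : ∀ W ω, cE μ W (X W) ω ≤ η * E := by
    intro W ω
    refine cE_le hμ0 (mul_nonneg hη hE.le) (fun ω hω => ?_) ω
    have hL : eInd H d ω ≤ η * E := by
      by_contra h
      rw [hμ] at hω
      simp [h] at hω
    refine le_trans ?_ hL
    rw [eInd]
    refine (sum_le_sum_of_subset_of_nonneg (filter_subset _ _) fun A hA _ => ?_).trans
      (sum_le_sum fun A _ => by rw [mul_ite, mul_one, mul_zero])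
    have := (hd A hA).le
    positivity
  have hpt : ∀ W ω, Φ * (1 - (σ W ω * (F W ω - cE μ W (X W) ω) + p ^ r * T W) / (ε * E)) ≤
      ∑ v ∈ Wᶜ, ip p (cP μ W v ω) := by
    intro W ω
    have hcP : ∀ v, cP μ W v ω ∈ Set.Icc (0 : ℝ) 1 := fun v =>
      ⟨cP_nonneg hμ0 W v ω, cP_le_one hμ0 W v ω⟩
    have hG : F W ω - cE μ W (X W) ω ≤ σ W ω * (F W ω - cE μ W (X W) ω) ∧
        0 ≤ σ W ω * (F W ω - cE μ W (X W) ω) := by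
      simp only [hσ]
      split_ifs with h
      · simpa using h
      · simpa using (not_le.1 h).le
    have hT0 : 0 ≤ T W := sum_nonneg fun A hA => by
      have := (hd A hA).le
      positivity
    by_cases hsmall : σ W ω * (F W ω - cE μ W (X W) ω) + p ^ r * T W ≤ ε * E
    · set q : V → ℝ := fun v => if v ∈ W then p else cP μ W v ω with hq
      have hq01 : ∀ v, q v ∈ Set.Icc (0 : ℝ) 1 := by
        intro v
        simp only [hq]
        split_ifs
        · exact ⟨hp.le, hp1.le⟩
        · exact hcP v
      have hqp : ∀ v, q v ≤ p := by
        intro v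
        simp only [hq]
        split_ifs with h
        · exact le_rfl
        · exact cP_le hp.le hμ0 hμp h ω
      have hexp : expE H d q ≤ F W ω + p ^ r * T W := by
        rw [expE_eq]
        simp only [hF, hT]
        rw [sum_filter, mul_sum, ← sum_add_distrib]
        refine sum_le_sum fun A hA => ?_
        split_ifs with h
        · rw [mul_zero, add_zero]
          refine le_of_eq ?_
          congr 1
          refine prod_congr rfl fun v hv => ?_
          simp only [hq, disjoint_left.1 h hv, if_false]
        · rw [zero_add, mul_comm, ← hr A hA, ← prod_const]
          exact mul_le_mul_of_nonneg_right (prod_le_prod (fun v _ => (hq01 v).1)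
            fun v _ => hqp v) (hd A hA).le
      have hΦle : Φ ≤ ∑ v, ip p (q v) :=
        PhiH_le hp hp1 hq01 (by linarith [hXle W ω, hG.1])
      have hsum : ∑ v, ip p (q v) = ∑ v ∈ Wᶜ, ip p (cP μ W v ω) := by
        rw [← sum_subset (subset_univ Wᶜ) fun v _ hv => ?_]
        · refine sum_congr rfl fun v hv => ?_
          simp only [hq, mem_compl.1 hv, if_false]
        · have hvW : v ∈ W := by simpa using hv
          simp only [hq, hvW, if_true, ip_self hp hp1]
      rw [hsum] at hΦle
      refine le_trans (mul_le_of_le_one_right hΦ0 ?_) hΦle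
      have : 0 ≤ (σ W ω * (F W ω - cE μ W (X W) ω) + p ^ r * T W) / (ε * E) := by
        have := hG.2
        positivity
      linarith
    · refine le_trans (mul_nonpos_of_nonneg_of_nonpos hΦ0 ?_)
        (sum_nonneg fun v _ => ip_nonneg hp hp1 (hcP v))
      rw [sub_nonpos, one_le_div (mul_pos hε hE)]
      exact (not_le.1 hsmall).le
  have hent : ∀ W, ∑ ω, μ ω * ∑ v ∈ Wᶜ, ip p (cP μ W v ω) ≤ -Real.log P := fun W =>
    sum_ip_cP_le hp hp1 (L := fun ω => eInd H d ω ≤ η * E)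
      (by rw [hP, lowPr]) hP0
      (by rw [hμ]) W
  have hσerr : ∀ W, ∑ ω, μ ω * (σ W ω * (F W ω - cE μ W (X W) ω)) =
      ∑ ω, μ ω * (σ W ω * ∑ A ∈ H with Disjoint A W,
        d A * (∏ v ∈ A, cP μ W v ω - if A ⊆ ω then 1 else 0)) := by
    intro W
    simp_rw [mul_sub]
    rw [sum_sub_distrib, sum_mul_cE hμ0 _ (hσdep W), ← sum_sub_distrib]
    refine sum_congr rfl fun ω _ => ?_
    rw [sum_sub_distrib, mul_sub, mul_sub]
  have hinner : ∀ W, Φ * (1 - ((∑ ω, μ ω * (σ W ω * (F W ω - cE μ W (X W) ω))) +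
      p ^ r * T W) / (ε * E)) ≤ -Real.log P := by
    intro W
    refine le_trans (le_of_eq ?_) ((sum_le_sum fun ω _ =>
      mul_le_mul_of_nonneg_left (hpt W ω) (hμ0 ω)).trans (hent W))
    calc _ = ∑ ω, (μ ω * Φ - (μ ω * (σ W ω * (F W ω - cE μ W (X W) ω))) * (Φ / (ε * E)) -
            μ ω * (p ^ r * T W * (Φ / (ε * E)))) := by
          rw [sum_sub_distrib, sum_sub_distrib, ← sum_mul, ← sum_mul, ← sum_mul, hμ1]
          ring
      _ = _ := sum_congr rfl fun ω _ => by ring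
  have houter := sum_le_sum fun W (_ : W ∈ univ) => mul_le_mul_of_nonneg_left (hinner W) (hρ W)
  rw [← sum_mul, hρ1, one_mul] at houter
  refine le_trans ?_ houter
  have hcalc : ∑ W, ρ W * (Φ * (1 - ((∑ ω, μ ω * (σ W ω * (F W ω - cE μ W (X W) ω))) +
      p ^ r * T W) / (ε * E))) = Φ * (1 - (∑ W, ρ W * ∑ ω, μ ω * (σ W ω *
        (F W ω - cE μ W (X W) ω)) + p ^ r * ∑ W, ρ W * T W) / (ε * E)) := by
    calc _ = ∑ W, (ρ W * Φ - (ρ W * ∑ ω, μ ω * (σ W ω * (F W ω - cE μ W (X W) ω))) *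
            (Φ / (ε * E)) - ρ W * T W * (p ^ r * (Φ / (ε * E)))) :=
          sum_congr rfl fun W _ => by ring
      _ = _ := by
          rw [sum_sub_distrib, sum_sub_distrib, ← sum_mul, ← sum_mul, ← sum_mul, hρ1]
          ring
  rw [hcalc, mul_comm]
  refine mul_le_mul_of_nonneg_left ?_ hΦ0
  have h1 := herr σ hσdep fun W ω => by
    simp only [hσ]
    split_ifs <;> simp
  simp_rw [← hσerr] at h1
  have h2 := mul_le_mul_of_nonneg_left htouch (pow_pos hp r).le
  have h3 : (∑ W, ρ W * ∑ ω, μ ω * (σ W ω * (F W ω - cE μ W (X W) ω)) +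
      p ^ r * ∑ W, ρ W * T W) / (ε * E) ≤ (δ₁ + δ₂) / ε := by
    rw [div_le_div_iff₀ (mul_pos hε hE) hε]
    have h4 : p ^ r * (δ₁ * eTot H d) = δ₁ * E := by rw [hEeq]; ring
    have h5 := mul_le_mul_of_nonneg_right (add_le_add h1 (h2.trans_eq h4)) hε.le
    linarith
  linarith

theorem lowPr_pos {H : Finset (Finset V)} {d : Finset V → ℝ} {r : ℕ} (hr0 : r ≠ 0)
    (hr : ∀ A ∈ H, #A = r) {p η : ℝ} (hp : 0 < p) (hp1 : p < 1) (hη : 0 ≤ η)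
    (hE : 0 ≤ expE H d fun _ => p) : 0 < lowPr H d p η := by
  have hπ : ∀ ω : Finset V, 0 ≤ pw (fun _ => p) ω := pw_nonneg fun _ => ⟨hp.le, hp1.le⟩
  refine sum_pos' (fun ω _ => ?_) ⟨∅, mem_univ _, ?_⟩
  · have := hπ ω
    positivity
  · have h : eInd H d ∅ = 0 := sum_eq_zero fun A hA => if_neg fun h => by
      rw [subset_empty] at h
      exact hr0 (by rw [← hr A hA, h, card_empty])
    rw [if_pos (by rw [h]; exact mul_nonneg hη hE), pw, prod_empty, one_mul]
    exact prod_pos fun v _ => sub_pos.2 hp1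

theorem lower_tail_of_degree_bound {H : Finset (Finset V)} {d : Finset V → ℝ} {r m : ℕ}
    {p η ε t K a : ℝ} (hr0 : r ≠ 0) (hp : 0 < p) (hp1 : p < 1) (hη : 0 ≤ η) (hε : 0 < ε)
    (ht : 0 < t) (ht1 : t ≤ 1 / 2) (hK : 0 ≤ K) (ha : 0 < a) (hm : 0 < m) (hH : H.Nonempty)
    (hr : ∀ A ∈ H, #A = r) (hd : ∀ A ∈ H, 0 < d A)
    (hdeg : ∀ B : Finset V, 1 ≤ #B → #B ≤ r →
      degH H d B ≤ K * (eTot H d / Fintype.card V) * (t * p) ^ (#B - 1)) :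
    (1 - (r * (m * t) + (a / (2 * m) + 4 * 2 ^ r * K ^ 2 / (2 * a))) / ε) *
      PhiH H d p (η + ε) ≤ -Real.log (lowPr H d p η) := by
  have hπ : ∀ ω : Finset V, 0 ≤ pw (fun _ => p) ω := pw_nonneg fun _ => ⟨hp.le, hp1.le⟩
  have he : 0 < eTot H d := sum_pos hd hH
  have hE : 0 < expE H d fun _ => p := by
    rw [expE_const hr]
    positivity
  obtain ⟨A₀, hA₀⟩ := hH
  have hn : 0 < Fintype.card V := by
    obtain ⟨v, -⟩ := card_pos.1 (Nat.pos_of_ne_zero (hr A₀ hA₀ ▸ hr0))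
    exact Fintype.card_pos_iff.2 ⟨v⟩
  have hn' : (0 : ℝ) < Fintype.card V := Nat.cast_pos.2 hn
  have hm' : (0 : ℝ) < m := Nat.cast_pos.2 hm
  have hP0 : 0 < lowPr H d p η := lowPr_pos hr0 hr hp hp1 hη hE.le
  set P := lowPr H d p η with hP
  set μ : Finset V → ℝ := fun ω =>
    (if eInd H d ω ≤ η * expE H d (fun _ => p) then pw (fun _ => p) ω else 0) / P with hμ
  have hμ0 : ∀ ω, 0 ≤ μ ω := fun ω => by
    have := hπ ω
    simp only [hμ]
    positivity
  have hμ1 : ∑ ω, μ ω = 1 := by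
    rw [hμ, ← sum_div, div_eq_one_iff_eq hP0.ne', hP, lowPr]
  have hμp : ∀ v ω, v ∉ ω → (1 - p) * μ (insert v ω) ≤ p * μ ω := by
    intro v ω hv
    simp only [hμ]
    rw [← mul_div_assoc, ← mul_div_assoc]
    refine div_le_div_of_nonneg_right ?_ hP0.le
    split_ifs with h1 h2 h2
    · exact (pw_insert (fun _ => p) hv).le
    · exact absurd ((eInd_mono hd (subset_insert v ω)).trans h1) h2
    · rw [mul_zero]
      exact mul_nonneg hp.le (hπ ω)
    · simp
  have ht01 : t ∈ Set.Icc (0 : ℝ) 1 := ⟨ht.le, by linarith⟩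
  obtain ⟨i, him, hi⟩ := exists_small_increment hp.le ht01 hμ0 hμ1 hμp hm
  refine one_sub_mul_PhiH_le hp hp1 hη hε hr hd hE hP hP0 hμ hμp (unionLaw_nonneg ht01 i)
    (sum_unionLaw t i) ?_ ?_
  · refine (sum_unionLaw_touching_le ht01 i hr hd).trans ?_
    have : (i : ℝ) ≤ m := Nat.cast_le.2 him.le
    gcongr
  · intro σ hσ hσ1
    set s : ℝ := a * p ^ r * eTot H d / (Fintype.card V * p ^ 2) with hs
    have hs0 : 0 < s := by positivity
    set C : ℝ := (Fintype.card V : ℝ) *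
      (4 * 2 ^ r * (K * (eTot H d / Fintype.card V) * p ^ (r - 1)) ^ 2 / (2 * s)) with hC
    calc _ ≤ ∑ W, unionLaw t i W * (s / 2 * ∑ U, pw (fun _ => t) U * ∑ v, ∑ ω, μ ω *
          (cP μ (W.erase v) v ω - cP μ ((W ∪ U).erase v) v ω) ^ 2 + C) :=
          sum_le_sum fun W _ => mul_le_mul_of_nonneg_left
            (sum_conditional_error_le hp ht ht1 hs0 hμ0 hμ1 hμp hr hd (by positivity) hdeg
              (hσ W) (hσ1 W)) (unionLaw_nonneg ht01 i W)
      _ = s / 2 * ∑ W, unionLaw t i W * ∑ U, pw (fun _ => t) U * ∑ v, ∑ ω, μ ω *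
          (cP μ (W.erase v) v ω - cP μ ((W ∪ U).erase v) v ω) ^ 2 + C := by
          simp_rw [mul_add]
          rw [sum_add_distrib, ← sum_mul, sum_unionLaw, one_mul, mul_sum]
          congr 1
          exact sum_congr rfl fun W _ => by ring
      _ ≤ s / 2 * (Fintype.card V * p ^ 2 / m) + C := by gcongr
      _ = _ := by
          rw [expE_const hr, hC, hs]
          obtain ⟨k, rfl⟩ := Nat.exists_eq_succ_of_ne_zero hr0
          rw [Nat.succ_eq_add_one, Nat.add_sub_cancel]
          field_simp
          ring

theorem PhiH_eq_zero_of_card_zero {H : Finset (Finset V)} {d : Finset V → ℝ}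
    (hr : ∀ A ∈ H, #A = 0) {p : ℝ} (hp : 0 < p) (hp1 : p < 1) (η : ℝ) : PhiH H d p η = 0 := by
  refine le_antisymm ?_ (PhiH_nonneg H d hp hp1 η)
  have hconst : ∀ q : V → ℝ, expE H d q = expE H d fun _ => p := by
    intro q
    rw [expE_eq, expE_eq]
    refine sum_congr rfl fun A hA => ?_
    rw [card_eq_zero.1 (hr A hA), prod_empty, prod_empty]
  by_cases h : expE H d (fun _ => p) ≤ η * expE H d fun _ => p
  · refine (PhiH_le hp hp1 (fun _ => ⟨hp.le, hp1.le⟩) h).trans ?_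
    simp [ip_self hp hp1]
  · rw [PhiH]
    refine le_of_eq ?_
    convert Real.sInf_empty
    rw [Set.eq_empty_iff_forall_notMem]
    rintro x ⟨q, -, hq, -⟩
    exact h (hconst q ▸ hq)

end Helpers

/-- Theorem `thm:main-hypergraphs`: for every integer `r` and all `p₀ < 1`, `ε > 0` and `K`,
there exist `λ > 0` and `C` such that for every nonempty `r`-uniform weighted hypergraph
`(H, d)` on a finite vertex set `V`, every `p ∈ (0, p₀]` satisfying the maximum-degree
conditions `Δ_s(H) ≤ K (λp)^{s-1} e(H)/v(H)` for all `s ∈ {1,…,r}`, and every `η ≥ 0`,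
`− log Pr(e(H[R]) ≤ η E[e(H[R])]) ≥ (1−ε) Φ_p^H(η+ε) − C`. -/
theorem main_hypergraphs (r : ℕ) (p₀ ε K : ℝ) (hp₀ : p₀ < 1) (hε : 0 < ε) :
    ∃ lam C : ℝ, 0 < lam ∧
      ∀ (V : Type) [Fintype V] [DecidableEq V]
        (H : Finset (Finset V)) (d : Finset V → ℝ),
        H.Nonempty → (∀ A ∈ H, A.card = r) → (∀ A ∈ H, 0 < d A) →
        ∀ p : ℝ, 0 < p → p ≤ p₀ →
        (∀ s : ℕ, 1 ≤ s → s ≤ r → ∀ B : Finset V, B.card = s →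
          degH H d B ≤ K * (lam * p) ^ (s - 1) * (eTot H d / (Fintype.card V : ℝ))) →
        ∀ η : ℝ, 0 ≤ η →
          - Real.log (lowPr H d p η) ≥ (1 - ε) * PhiH H d p (η + ε) - C := by

  rcases eq_or_ne r 0 with rfl | hr0
  · refine ⟨1, 0, one_pos, ?_⟩
    intro V _ _ H d _ hr _ p hp hpp _ η _
    rw [PhiH_eq_zero_of_card_zero hr hp (hpp.trans_lt hp₀)]
    have hπ := pw_nonneg (V := V) (q := fun _ => p) fun _ => ⟨hp.le, (hpp.trans_lt hp₀).le⟩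
    have h0 : 0 ≤ lowPr H d p η := Finset.sum_nonneg fun ω _ => by
      have := hπ ω
      positivity
    have h1 : lowPr H d p η ≤ 1 := by
      rw [← sum_pw fun _ : V => p]
      refine Finset.sum_le_sum fun ω _ => ?_
      split_ifs
      · exact le_rfl
      · exact hπ ω
    have := Real.log_nonpos h0 h1
    simp only [mul_zero, sub_zero]
    linarith
  have hr1 : (0 : ℝ) < r := Nat.cast_pos.2 (Nat.pos_of_ne_zero hr0)
  set a : ℝ := (4 * 2 ^ r * |K| ^ 2 + 1) * (2 / ε ^ 2) with ha
  have ha0 : 0 < a := by positivity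
  obtain ⟨m, hm⟩ := exists_nat_gt (2 * a / ε ^ 2)
  have hm0 : (0 : ℝ) < m := lt_trans (by positivity) hm
  set t : ℝ := min (1 / 2) (ε ^ 2 / (2 * r * m)) with ht
  have ht0 : 0 < t := lt_min (by norm_num) (by positivity)
  refine ⟨t, 0, ht0, ?_⟩
  intro V _ _ H d hH hr hd p hp hpp hdeg η hη
  have hp1 : p < 1 := hpp.trans_lt hp₀
  have he : 0 < eTot H d := Finset.sum_pos hd hH
  have hmain := lower_tail_of_degree_bound (K := |K|) hr0 hp hp1 hη hε ht0 (min_le_left _ _)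
    (abs_nonneg K) ha0 (Nat.cast_pos.1 hm0) hH hr hd fun B hB1 hBr => by
      refine (hdeg _ hB1 hBr B rfl).trans ?_
      rw [mul_right_comm]
      gcongr
      exact le_abs_self K
  have h1 : r * (m * t) ≤ ε ^ 2 / 2 := by
    have h := mul_le_mul_of_nonneg_left (min_le_right (1 / 2) (ε ^ 2 / (2 * r * m)))
      (mul_pos hr1 hm0).le
    rw [← ht] at h
    refine (le_of_eq (by ring)).trans (h.trans (le_of_eq ?_))
    field_simp
  have h2 : a / (2 * m) ≤ ε ^ 2 / 4 := by
    rw [div_lt_iff₀ (by positivity)] at hm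
    rw [div_le_div_iff₀ (by positivity) (by norm_num)]
    nlinarith
  have h3 : 4 * 2 ^ r * |K| ^ 2 / (2 * a) ≤ ε ^ 2 / 4 := by
    rw [div_le_iff₀ (by positivity), ha]
    have : ε ^ 2 / 4 * (2 * ((4 * 2 ^ r * |K| ^ 2 + 1) * (2 / ε ^ 2))) =
        4 * 2 ^ r * |K| ^ 2 + 1 := by
      field_simp
      ring
    rw [this]
    linarith
  have h4 : (r * (m * t) + (a / (2 * m) + 4 * 2 ^ r * |K| ^ 2 / (2 * a))) / ε ≤ ε := by
    rw [div_le_iff₀ hε]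
    nlinarith
  rw [sub_zero]
  refine le_trans (mul_le_mul_of_nonneg_right ?_ (PhiH_nonneg H d hp hp1 _)) hmain
  linarith

end
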